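/- For every real k, every real μ, and every s > 0, ∫₀^∞ e^{−s t} · (1/√(2π t)) · exp(−(k − μ t)²/(2 t) − μ k) dt = (1/√(2 s + μ²)) · exp(−|k| · √(2 s + μ²)). -/

import Mathlib

open MeasureTheory Real Set Filter

/-- The Gaussian primitive `∫₀ˣ e^{-u²/2} du`. -/
noncomputable def gaussianPrimitive (x : ℝ) : ℝ := ∫ u in (0 : ℝ)..x, Real.exp (-(1 / 2) * u ^ 2)

theorem hasDerivAt_gaussianPrimitive (x : ℝ) :
    HasDerivAt gaussianPrimitive (Real.exp (-(1 / 2) * x ^ 2)) x :=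
  (show Continuous fun u : ℝ => Real.exp (-(1 / 2) * u ^ 2) by fun_prop).integral_hasStrictDerivAt
    0 x |>.hasDerivAt

theorem gaussianPrimitive_neg (x : ℝ) : gaussianPrimitive (-x) = -gaussianPrimitive x := by
  have h := intervalIntegral.integral_comp_neg (a := 0) (b := x)
    (fun u : ℝ => Real.exp (-(1 / 2) * u ^ 2))
  simp only [neg_sq, neg_zero] at h
  rw [gaussianPrimitive, gaussianPrimitive, h, intervalIntegral.integral_symm]

theorem tendsto_gaussianPrimitive_atTop :
    Tendsto gaussianPrimitive atTop (nhds (√(2 * π) / 2)) := by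
  have h := intervalIntegral_tendsto_integral_Ioi 0
    (integrable_exp_neg_mul_sq (b := 1 / 2) (by norm_num)).integrableOn tendsto_id
  rw [integral_gaussian_Ioi, show π / (1 / 2) = 2 * π by ring] at h
  exact h

theorem tendsto_gaussianPrimitive_atBot :
    Tendsto gaussianPrimitive atBot (nhds (-(√(2 * π) / 2))) := by
  refine (tendsto_gaussianPrimitive_atTop.comp tendsto_neg_atBot_atTop).neg.congr fun x => ?_
  simp [gaussianPrimitive_neg]

/-- Improper fundamental theorem of calculus on `(a, ∞)` for a nonnegative derivative, with a
one-sided limit at `a` instead of continuity. -/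
theorem integral_Ioi_of_hasDerivAt_of_nonneg_of_tendsto {f f' : ℝ → ℝ} {a l m : ℝ}
    (hderiv : ∀ x ∈ Ioi a, HasDerivAt f (f' x) x) (hnonneg : ∀ x ∈ Ioi a, 0 ≤ f' x)
    (hl : Tendsto f (nhdsWithin a (Ioi a)) (nhds l)) (hm : Tendsto f atTop (nhds m)) :
    ∫ x in Ioi a, f' x = m - l := by
  have h := integral_Ioi_of_hasDerivAt_of_nonneg (g := Function.update f a l) (g' := f')
    (a := a) (l := m) ?_ ?_ hnonneg ?_
  · simpa using h
  · rw [continuousWithinAt_update_same, Ici_sdiff_left]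
    exact hl
  · intro x hx
    refine (hderiv x hx).congr_of_eventuallyEq ?_
    filter_upwards [lt_mem_nhds hx] with y hy
    exact Function.update_of_ne (ne_of_gt hy) _ _
  · refine hm.congr' ?_
    filter_upwards [eventually_gt_atTop a] with y hy
    exact (Function.update_of_ne (ne_of_gt hy) _ _).symm

/-- An antiderivative of `exp (-(a √t - b / √t)² / 2) / √t`. -/
noncomputable def inverseGaussianPrimitive (a b t : ℝ) : ℝ :=
  a⁻¹ * (gaussianPrimitive (a * √t - b / √t) +
    Real.exp (2 * a * b) * gaussianPrimitive (a * √t + b / √t))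

theorem hasDerivAt_inverseGaussianPrimitive {a t : ℝ} (b : ℝ) (ha : 0 < a) (ht : 0 < t) :
    HasDerivAt (inverseGaussianPrimitive a b)
      (Real.exp (-(1 / 2) * (a * √t - b / √t) ^ 2) / √t) t := by
  have hr : 0 < √t := sqrt_pos.2 ht
  have hs := Real.hasDerivAt_sqrt ht.ne'
  have hd := (hasDerivAt_const t b).div hs hr.ne'
  have h1 := (hasDerivAt_gaussianPrimitive (a * √t - b / √t)).comp t ((hs.const_mul a).sub hd)
  have h2 := (hasDerivAt_gaussianPrimitive (a * √t + b / √t)).comp t ((hs.const_mul a).add hd)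
  have h := (h1.add (h2.const_mul (Real.exp (2 * a * b)))).const_mul a⁻¹
  refine h.congr_deriv ?_
  have key : Real.exp (2 * a * b) * Real.exp (-(1 / 2) * (a * √t + b / √t) ^ 2) =
      Real.exp (-(1 / 2) * (a * √t - b / √t) ^ 2) := by
    rw [← Real.exp_add]
    congr 1
    field_simp
    ring
  rw [← mul_assoc (Real.exp (2 * a * b)), key]
  field_simp
  ring

theorem tendsto_inverseGaussianPrimitive_atTop {a : ℝ} (b : ℝ) (ha : 0 < a) :
    Tendsto (inverseGaussianPrimitive a b) atTop
      (nhds (a⁻¹ * (√(2 * π) / 2 + Real.exp (2 * a * b) * (√(2 * π) / 2)))) := by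
  have h1 : Tendsto (fun t => a * √t) atTop atTop := tendsto_sqrt_atTop.const_mul_atTop ha
  have h2 : Tendsto (fun t => b / √t) atTop (nhds 0) := tendsto_sqrt_atTop.const_div_atTop b
  have h3 : Tendsto (fun t => a * √t - b / √t) atTop atTop := by
    simpa only [sub_eq_add_neg] using h1.atTop_add h2.neg
  exact ((tendsto_gaussianPrimitive_atTop.comp h3).add
    ((tendsto_gaussianPrimitive_atTop.comp (h1.atTop_add h2)).const_mul _)).const_mul _

theorem tendsto_inverseGaussianPrimitive_zero {a b : ℝ} (hb : 0 ≤ b) :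
    Tendsto (inverseGaussianPrimitive a b) (nhdsWithin 0 (Ioi 0))
      (nhds (a⁻¹ * (-(√(2 * π) / 2) + Real.exp (2 * a * b) * (√(2 * π) / 2)))) := by
  have hs : Tendsto (fun t => √t) (nhdsWithin 0 (Ioi 0)) (nhds 0) := by
    simpa using (continuous_sqrt.tendsto 0).mono_left nhdsWithin_le_nhds
  have h1 : Tendsto (fun t => a * √t) (nhdsWithin 0 (Ioi 0)) (nhds 0) := by
    simpa using hs.const_mul a
  rcases hb.eq_or_lt with rfl | hb
  · have h := (hasDerivAt_gaussianPrimitive 0).continuousAt.tendsto.comp h1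
    have h0 : gaussianPrimitive 0 = 0 := intervalIntegral.integral_same
    rw [h0] at h
    have h' := (h.add h).const_mul a⁻¹
    convert h' using 2
    · simp [inverseGaussianPrimitive]
    · simp
  · have hs' : Tendsto (fun t => √t) (nhdsWithin 0 (Ioi 0)) (nhdsWithin 0 (Ioi 0)) :=
      tendsto_nhdsWithin_iff.2 ⟨hs, eventually_mem_nhdsWithin.mono fun _ ht => sqrt_pos.2 ht⟩
    have h2 : Tendsto (fun t => b / √t) (nhdsWithin 0 (Ioi 0)) atTop := by
      simpa only [div_eq_mul_inv, Function.comp_def] using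
        (tendsto_inv_nhdsGT_zero.comp hs').const_mul_atTop hb
    have h3 : Tendsto (fun t => a * √t - b / √t) (nhdsWithin 0 (Ioi 0)) atBot := by
      simpa only [sub_eq_add_neg, Function.comp_def] using
        h1.add_atBot (tendsto_neg_atTop_atBot.comp h2)
    exact ((tendsto_gaussianPrimitive_atBot.comp h3).add
      ((tendsto_gaussianPrimitive_atTop.comp (h1.add_atTop h2)).const_mul _)).const_mul _

theorem integral_exp_neg_sq_sub_div_sqrt {a b : ℝ} (ha : 0 < a) (hb : 0 ≤ b) :
    ∫ t in Ioi (0 : ℝ), Real.exp (-(1 / 2) * (a * √t - b / √t) ^ 2) / √t = √(2 * π) / a := by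
  rw [integral_Ioi_of_hasDerivAt_of_nonneg_of_tendsto
    (fun t ht => hasDerivAt_inverseGaussianPrimitive b ha ht) (fun t _ => by positivity)
    (tendsto_inverseGaussianPrimitive_zero hb) (tendsto_inverseGaussianPrimitive_atTop b ha)]
  field_simp
  ring

/-- For every real `k`, `μ`, and every `s > 0`,
`∫₀^∞ e^{−s t} · (1/√(2π t)) · exp(−(k − μ t)²/(2t) − μ k) dt
  = (1/√(2s + μ²)) · exp(−|k| √(2s + μ²))`. -/
theorem laplace_gaussian (k μ s : ℝ) (hs : 0 < s) :
    ∫ t in Ioi (0 : ℝ),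
        Real.exp (-s * t) * (1 / Real.sqrt (2 * Real.pi * t)) *
          Real.exp (-(k - μ * t) ^ 2 / (2 * t) - μ * k)
      = 1 / Real.sqrt (2 * s + μ ^ 2) * Real.exp (-|k| * Real.sqrt (2 * s + μ ^ 2)) := by
  have hpos : 0 < 2 * s + μ ^ 2 := by positivity
  set a := √(2 * s + μ ^ 2)
  have ha : 0 < a := sqrt_pos.2 hpos
  have ha2 : a ^ 2 = 2 * s + μ ^ 2 := sq_sqrt hpos.le
  have hpi : 0 < √(2 * π) := sqrt_pos.2 (by positivity)
  have hint : ∀ t ∈ Ioi (0 : ℝ),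
      Real.exp (-s * t) * (1 / √(2 * π * t)) * Real.exp (-(k - μ * t) ^ 2 / (2 * t) - μ * k) =
        Real.exp (-|k| * a) / √(2 * π) *
          (Real.exp (-(1 / 2) * (a * √t - |k| / √t) ^ 2) / √t) := by
    intro t ht
    have ht : 0 < t := ht
    have hr : 0 < √t := sqrt_pos.2 ht
    have hexp : -s * t + (-(k - μ * t) ^ 2 / (2 * t) - μ * k) =
        -|k| * a + -(1 / 2) * (a * √t - |k| / √t) ^ 2 := by
      have hsq : (a * √t - |k| / √t) ^ 2 = (2 * s + μ ^ 2) * t - 2 * a * |k| + k ^ 2 / t := by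
        rw [sub_sq, mul_pow, div_pow, sq_sqrt ht.le, sq_abs, ha2]
        field_simp
      rw [hsq]
      field_simp
      ring
    rw [sqrt_mul (by positivity), mul_right_comm, ← Real.exp_add, hexp, Real.exp_add]
    field_simp
  rw [setIntegral_congr_fun measurableSet_Ioi hint, integral_const_mul,
    integral_exp_neg_sq_sub_div_sqrt ha (abs_nonneg k)]
  field_simp
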